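/- Let L be a first-order language and T a model complete L-theory. Let k ≥ 1, let φ(x,y) be an L-formula in two k-tuples of free variables, let M₀ be a model of T in which the relation u < v on k-tuples defined by φ(u,v) is transitive and irreflexive, let (a_i)_{i<ω} be k-tuples of M₀ with a_i < a_j for all i < j < ω, and let σ₀ be an L-automorphism of M₀ with σ₀(a_i) = a_{i+1} (componentwise) for every i < ω. Suppose TA is a model companion of T_σ and (N,σ) is a model of TA extending the L_σ-structure (M₀,σ₀), and suppose N is κ-saturated as an L-structure for some cardinal κ > 2^(|L|+ℵ₀). Then for every k-tuple c of N with a_i < c for all i < ω, there exists a k-tuple y of N such that a₀ < σ(y), σ(y) < y, and y < c (where σ is applied componentwise to tuples). -/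

import Mathlib

universe u v

open FirstOrder Language Structure Cardinal

/-- The language with a single unary function symbol `σ` and no other symbols. -/
def unaryFunctionLanguage : FirstOrder.Language.{0, 0} where
  Functions := fun n => match n with
    | 1 => Unit
    | _ => Empty
  Relations := fun _ => Empty

/-- `L_σ`: the language `L` expanded by one new unary function symbol `σ`. -/
abbrev Lsigma (L : FirstOrder.Language.{u, v}) : FirstOrder.Language :=
  L.sum unaryFunctionLanguage

/-- The interpretation of the new unary function symbol `σ` in an `L_σ`-structure. -/
def sigmaMap (L : FirstOrder.Language.{u, v}) (M : Type w) [(Lsigma L).Structure M] :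
    M → M :=
  fun x => funMap (L := Lsigma L) (M := M)
    ((Sum.inr () : L.Functions 1 ⊕ unaryFunctionLanguage.Functions 1)) ![x]

/-- The `L_σ`-structure on an `L`-structure `M` in which `σ` is interpreted by `f`. -/
def structureWithSigma (L : FirstOrder.Language.{u, v}) (M : Type w) [L.Structure M]
    (f : M → M) : (Lsigma L).Structure M :=
  letI : unaryFunctionLanguage.Structure M :=
    { funMap := fun {n} g x =>
        match n, g, x with
        | 1, _, x => f (x 0)
        | 0, g, _ => nomatch g
        | (_ + 2), g, _ => nomatch g
      RelMap := fun {_} r _ => nomatch r }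
  Language.sumStructure L unaryFunctionLanguage M

/-- `M` is a model of `T_σ = T ∪ {"σ is an L-automorphism"}`: the `L`-reduct of `M`
models `T` and the interpretation of `σ` is an `L`-automorphism of the reduct. -/
def IsModelOfTsigma (L : FirstOrder.Language.{u, v}) (T : L.Theory) (M : Type w)
    [(Lsigma L).Structure M] : Prop :=
  letI : L.Structure M := (LHom.sumInl (L := L) (L' := unaryFunctionLanguage)).reduct M
  M ⊨ T ∧ ∃ e : M ≃[L] M, ⇑e = sigmaMap L M

/-- An embedding between structures is elementary if it preserves the realization of all
first-order formulas. -/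
def Embedding.IsElem {L' : FirstOrder.Language.{u2, v2}} {M N : Type*} [L'.Structure M]
    [L'.Structure N] (f : M ↪[L'] N) : Prop :=
  ∀ {n : ℕ} (φ : L'.Formula (Fin n)) (x : Fin n → M), φ.Realize (⇑f ∘ x) ↔ φ.Realize x

/-- A theory is model complete if every embedding between its models is elementary. -/
def TheoryIsModelComplete (L' : FirstOrder.Language.{u2, v2}) (T' : L'.Theory) : Prop :=
  ∀ (M N : Type (max u2 v2)) [L'.Structure M] [L'.Structure N],
    M ⊨ T' → N ⊨ T' → ∀ f : M ↪[L'] N, Embedding.IsElem f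

/-- An `L`-structure `N` is `κ`-saturated if every set of `L`-formulas in one (finite)
tuple of variables with parameters from a subset of `N` of cardinality `< κ`, every
finite subset of which is realized in `N`, is realized in `N`. -/
def IsSaturatedStruct (L : FirstOrder.Language.{u, v}) (N : Type w) [L.Structure N]
    (κ : Cardinal.{w}) : Prop :=
  ∀ A : Set N, #A < κ →
    ∀ (n : ℕ) (p : Set ((L[[↥A]]).Formula (Fin n))),
      (∀ q : Finset ((L[[↥A]]).Formula (Fin n)), ↑q ⊆ p →
        ∃ x : Fin n → N, ∀ ψ ∈ q, ψ.Realize x) →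
      ∃ x : Fin n → N, ∀ ψ ∈ p, ψ.Realize x

/-- An `L_σ`-structure `N` is `κ`-saturated as an `L`-structure. -/
def IsSaturatedLReduct (L : FirstOrder.Language.{u, v}) (N : Type w)
    [(Lsigma L).Structure N] (κ : Cardinal.{w}) : Prop :=
  letI : L.Structure N := (LHom.sumInl (L := L) (L' := unaryFunctionLanguage)).reduct N
  IsSaturatedStruct L N κ

/-- Realization, in the `L`-reduct of an `L_σ`-structure `N`, of an `L`-formula. -/
def RealizeL (L : FirstOrder.Language.{u, v}) {α : Type*} (N : Type w)
    [(Lsigma L).Structure N] (φ : L.Formula α) (x : α → N) : Prop :=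
  letI : L.Structure N := (LHom.sumInl (L := L) (L' := unaryFunctionLanguage)).reduct N
  φ.Realize x


section Helpers

open FirstOrder FirstOrder.Language FirstOrder.Language.Structure Cardinal

theorem compact_family {L : FirstOrder.Language.{u, v}} {α : Type (max u v)} {I : Type*}
    (F : I → L.Formula α)
    (hF : ∀ t : Finset I, ∃ (D : Type (max u v)) (_ : L.Structure D) (_ : Nonempty D) (w : α → D),
      ∀ i ∈ t, (F i).Realize w) :
    ∃ (D : Type (max u v)) (_ : L.Structure D) (_ : Nonempty D) (w : α → D),
      ∀ i, (F i).Realize w := by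
  classical
  have hs : Theory.IsSatisfiable (Set.range (fun i => Formula.equivSentence (F i))) := by
    rw [Theory.isSatisfiable_iff_isFinitelySatisfiable]
    intro T0 hT0
    rw [← Set.image_univ, Finset.subset_set_image_iff] at hT0
    obtain ⟨t, -, rfl⟩ := hT0
    obtain ⟨D, sD, nD, w, hw⟩ := hF t
    let := constantsOn.structure w
    have : D ⊨ ((Finset.image (fun i => Formula.equivSentence (F i)) t : Finset _) : (L[[α]]).Theory) := by
      refine ⟨fun ψ hψ => ?_⟩
      simp only [Finset.coe_image, Set.mem_image, Finset.mem_coe] at hψ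
      obtain ⟨i, hi, rfl⟩ := hψ
      rw [Formula.realize_equivSentence]
      exact hw i hi
    exact Theory.Model.isSatisfiable D
  obtain ⟨D⟩ := hs
  let : L.Structure D := (L.lhomWithConstants α).reduct D
  refine ⟨D, inferInstance, inferInstance, fun a => (L.con a : D), fun i => ?_⟩
  rw [← Formula.realize_equivSentence]
  exact Theory.realize_sentence_of_mem (Set.range (fun i => Formula.equivSentence (F i))) ⟨i, rfl⟩

theorem jep {L : FirstOrder.Language.{u, v}} {X : Type (max u v)} {B C : Type (max u v)}
    [L.Structure B] [L.Structure C] [Nonempty B] (b : X → B) (c : X → C)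
    (h : ∀ ψ : L.Formula X, ψ.Realize c → ψ.Realize b) :
    ∃ (D : Type (max u v)) (_ : L.Structure D) (_ : Nonempty D) (e : B ↪ₑ[L] D) (g : C ↪ₑ[L] D),
      ∀ x, e (b x) = g (c x) := by
  classical
  let I := {ψ : L.Formula B // ψ.Realize id} ⊕ ({ψ : L.Formula C // ψ.Realize id} ⊕ X)
  let F : I → L.Formula (B ⊕ C) := Sum.elim (fun ψ => ψ.1.relabel Sum.inl)
    (Sum.elim (fun ψ => ψ.1.relabel Sum.inr)
      (fun x => Term.equal (Term.var (Sum.inl (b x))) (Term.var (Sum.inr (c x)))))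
  obtain ⟨D, sD, nD, w, hw⟩ := compact_family F (by
    intro t
    refine ⟨B, inferInstance, inferInstance, ?_⟩
    let Ct : t → L.Formula C := fun i => Sum.elim (fun _ => ⊤) (Sum.elim (fun ψ => ψ.1) (fun _ => ⊤)) i.1
    let Ψ : L.Formula C := Formula.iInf Ct
    have hΨ : Ψ.Realize (id : C → C) := by
      rw [Formula.realize_iInf]
      rintro ⟨(ψ | ψ | x), hi⟩
      · exact Formula.realize_top.2 trivial
      · exact ψ.2
      · exact Formula.realize_top.2 trivial
    let X0 : Finset X := t.preimage (fun x => Sum.inr (Sum.inr x)) (fun x _ y _ hxy => Sum.inr_injective (Sum.inr_injective hxy))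
    let s : Finset C := BoundedFormula.freeVarFinset Ψ ∪ X0.image c
    have hs : (BoundedFormula.freeVarFinset Ψ : Set C) ⊆ (s : Set C) := by simp [s]
    have hs2 : ∀ x : X0, c x.1 ∈ (s : Set C) := fun x => by
      simp only [s, Finset.coe_union, Finset.coe_image]
      exact Or.inr ⟨x.1, x.2, rfl⟩
    let Ψ' : L.Formula (s : Set C) := BoundedFormula.restrictFreeVar Ψ (Set.inclusion hs)
    let θ : L.Formula X := Formula.iExs (s : Set C)
      ((Ψ'.relabel Sum.inr) ⊓ Formula.iInf (fun x : X0 =>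
        Term.equal (Term.var (Sum.inr (⟨c x.1, hs2 x⟩ : (s : Set C)))) (Term.var (Sum.inl x.1))))
    have h1 : θ.Realize c := by
      rw [Formula.realize_iExs]
      refine ⟨fun y => y.1, ?_⟩
      rw [Formula.realize_inf, Formula.realize_relabel, Formula.realize_iInf]
      refine ⟨?_, fun x => ?_⟩
      · exact (BoundedFormula.realize_restrictFreeVar' hs).2 hΨ
      · simp [Formula.realize_equal]
    have h2 := h θ h1
    rw [Formula.realize_iExs] at h2
    obtain ⟨w, hw⟩ := h2
    rw [Formula.realize_inf, Formula.realize_relabel, Formula.realize_iInf] at hw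
    obtain ⟨hw1, hw2⟩ := hw
    let w' : C → B := fun y => if hy : y ∈ (s : Set C) then w ⟨y, hy⟩ else Classical.arbitrary B
    have hw' : w = w' ∘ (↑) := by
      funext y
      simp only [w', Function.comp]
      rw [dif_pos y.2]
    have hw3 : Ψ.Realize w' := by
      refine (BoundedFormula.realize_restrictFreeVar' hs).1 ?_
      have : (Sum.elim b w ∘ Sum.inr) = w := rfl
      rw [this, hw'] at hw1
      exact hw1
    rw [Formula.realize_iInf] at hw3
    refine ⟨Sum.elim id w', ?_⟩
    rintro (ψ | ψ | x) hi
    · simp only [F, Sum.elim_inl, Formula.realize_relabel]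
      exact ψ.2
    · simp only [F, Sum.elim_inl, Sum.elim_inr, Formula.realize_relabel]
      exact hw3 ⟨_, hi⟩
    · have hx : x ∈ X0 := Finset.mem_preimage.2 hi
      have := hw2 ⟨x, hx⟩
      rw [hw'] at this
      simp only [Formula.realize_equal, Term.realize_var, Sum.elim_inl, Sum.elim_inr, Function.comp] at this
      simp only [F, Sum.elim_inr, Formula.realize_equal, Term.realize_var, Sum.elim_inl, id]
      exact this.symm)
  refine ⟨D, sD, nD, ⟨w ∘ Sum.inl, ?_⟩, ⟨w ∘ Sum.inr, ?_⟩, fun x => ?_⟩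
  · have key : ∀ {n : ℕ} (φ : L.Formula (Fin n)) (x : Fin n → B), φ.Realize x →
        φ.Realize ((w ∘ Sum.inl) ∘ x) := by
      intro n φ x hx
      have := hw (Sum.inl ⟨φ.relabel x, by rw [Formula.realize_relabel]; exact hx⟩)
      simp only [F, Sum.elim_inl, Formula.realize_relabel] at this
      exact this
    intro n φ x
    refine ⟨fun hx => ?_, key φ x⟩
    by_contra hn
    exact Formula.realize_not.1 (key φ.not x (Formula.realize_not.2 hn)) hx
  · have key : ∀ {n : ℕ} (φ : L.Formula (Fin n)) (x : Fin n → C), φ.Realize x →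
        φ.Realize ((w ∘ Sum.inr) ∘ x) := by
      intro n φ x hx
      have := hw (Sum.inr (Sum.inl ⟨φ.relabel x, by rw [Formula.realize_relabel]; exact hx⟩))
      simp only [F, Sum.elim_inl, Sum.elim_inr, Formula.realize_relabel] at this
      exact this
    intro n φ x
    refine ⟨fun hx => ?_, key φ x⟩
    by_contra hn
    exact Formula.realize_not.1 (key φ.not x (Formula.realize_not.2 hn)) hx
  · have := hw (Sum.inr (Sum.inr x))
    simp only [F, Sum.elim_inr, Formula.realize_equal, Term.realize_var] at this
    exact this

theorem chain_limit {L : FirstOrder.Language.{u, v}} (C : ℕ → Type w) [∀ n, L.Structure (C n)]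
    (t : ∀ n, C n ↪[L] C (n + 1)) :
    ∃ (E : Type w) (_ : L.Structure E) (g : ∀ n, C n ↪[L] E),
      (∀ n x, g (n + 1) (t n x) = g n x) ∧ (∀ x, ∃ n y, g n y = x) ∧
      ∀ s : ∀ n, C n ↪[L] E, (∀ n x, s (n + 1) (t n x) = s n x) →
        ∃ S : E ↪[L] E, ∀ n x, S (g n x) = s n x := by
  have hstep : ∀ n x, DirectedSystem.natLERec t n (n + 1) (Nat.le_succ n) x = t n x := by
    intro n x
    rw [DirectedSystem.coe_natLERec]
    exact Nat.leRecOn_succ' _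
  refine ⟨FirstOrder.Language.DirectLimit C (DirectedSystem.natLERec t), inferInstance,
    fun n => FirstOrder.Language.DirectLimit.of L ℕ C (DirectedSystem.natLERec t) n, ?_, ?_, ?_⟩
  · intro n x
    rw [← hstep]
    exact FirstOrder.Language.DirectLimit.of_f
  · exact FirstOrder.Language.DirectLimit.exists_of
  · intro s hs
    have : ∀ i j hij x, s j (DirectedSystem.natLERec t i j hij x) = s i x := by
      intro i j hij x
      rw [DirectedSystem.coe_natLERec]
      beta_reduce
      induction j, hij using Nat.le_induction with
      | base => rw [Nat.leRecOn_self]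
      | succ j hij ih => rw [Nat.leRecOn_succ hij, hs, ih]
    exact ⟨FirstOrder.Language.DirectLimit.lift L ℕ C _ s this, fun n x => FirstOrder.Language.DirectLimit.lift_of ..⟩

/-- Tarski's elementary chain theorem. -/
theorem chain_elem {L : FirstOrder.Language.{u, v}} (C : ℕ → Type w) [∀ n, L.Structure (C n)]
    (t : ∀ n, C n ↪ₑ[L] C (n + 1)) (E : Type*) [L.Structure E] (g : ∀ n, C n ↪[L] E)
    (hg : ∀ n x, g (n + 1) (t n x) = g n x) (hsur : ∀ x, ∃ n y, g n y = x) :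
    ∀ {α : Type*} {l : ℕ} (ψ : L.BoundedFormula α l) (n : ℕ) (w : α → C n) (xs : Fin l → C n),
      ψ.Realize (g n ∘ w) (g n ∘ xs) ↔ ψ.Realize w xs := by
  have push : ∀ n m, n ≤ m → ∃ T : C n ↪ₑ[L] C m, ∀ x, g m (T x) = g n x := by
    intro n m hnm
    induction m, hnm using Nat.le_induction with
    | base => exact ⟨ElementaryEmbedding.refl L _, fun x => rfl⟩
    | succ m _ ih =>
      obtain ⟨T, hT⟩ := ih
      exact ⟨(t m).comp T, fun x => by rw [ElementaryEmbedding.comp_apply, hg, hT]⟩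
  intro α l ψ
  induction ψ with
  | falsum => intros; rfl
  | equal t₁ t₂ =>
    intro n w xs
    simp only [BoundedFormula.Realize, ← Sum.comp_elim]
    rw [HomClass.realize_term, HomClass.realize_term, (g n).injective.eq_iff]
  | rel R ts =>
    intro n w xs
    simp only [BoundedFormula.Realize, ← Sum.comp_elim]
    rw [← (g n).map_rel R]
    simp only [Function.comp_def]
    refine iff_of_eq (congrArg _ (funext fun i => ?_))
    exact HomClass.realize_term (g n)
  | imp f₁ f₂ ih1 ih2 =>
    intro n w xs
    simp only [BoundedFormula.realize_imp, ih1, ih2]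
  | all f ih =>
    intro n w xs
    simp only [BoundedFormula.realize_all]
    constructor
    · intro H x
      rw [← ih, Fin.comp_snoc]
      exact H (g n x)
    · intro H x
      obtain ⟨m, y, rfl⟩ := hsur x
      obtain ⟨T, hT⟩ := push n (max n m) (le_max_left _ _)
      obtain ⟨T', hT'⟩ := push m (max n m) (le_max_right _ _)
      have h1 : (f.all).Realize w xs := BoundedFormula.realize_all.2 H
      rw [← T.map_boundedFormula, BoundedFormula.realize_all] at h1
      have h2 := h1 (T' y)
      rw [← ih, Fin.comp_snoc, hT'] at h2
      have e1 : g (max n m) ∘ T ∘ w = g n ∘ w := funext fun a => hT _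
      have e2 : g (max n m) ∘ T ∘ xs = g n ∘ xs := funext fun a => hT _
      rw [e1, e2] at h2
      exact h2

theorem chain_elem' {L : FirstOrder.Language.{u, v}} (C : ℕ → Type w) [∀ n, L.Structure (C n)]
    (t : ∀ n, C n ↪ₑ[L] C (n + 1)) (E : Type*) [L.Structure E] (g : ∀ n, C n ↪[L] E)
    (hg : ∀ n x, g (n + 1) (t n x) = g n x) (hsur : ∀ x, ∃ n y, g n y = x) (n : ℕ) :
    ∃ G : C n ↪ₑ[L] E, ∀ x, G x = g n x := by
  refine ⟨⟨g n, fun l ψ x => ?_⟩, fun x => rfl⟩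
  have := chain_elem C t E g hg hsur ψ n x default
  rw [Formula.Realize, Formula.Realize, ← this]
  have h0 : (g n ∘ default : Fin 0 → E) = default := Subsingleton.elim _ _
  rw [h0]

structure PairState (L : FirstOrder.Language.{u, v}) where
  B : Type (max u v)
  D : Type (max u v)
  sB : L.Structure B
  sD : L.Structure D
  nD : Nonempty D
  e : B ↪ₑ[L] D
  h : B ↪ₑ[L] D

attribute [instance] PairState.sB PairState.sD PairState.nD

theorem PairState.exists_next {L : FirstOrder.Language.{u, v}} (P : PairState L) :
    ∃ (D : Type (max u v)) (_ : L.Structure D) (_ : Nonempty D) (e : P.D ↪ₑ[L] D)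
      (g : P.D ↪ₑ[L] D), ∀ x, e (P.h x) = g (P.e x) :=
  jep P.h P.e (fun ψ hψ => by
    have h1 := P.e.map_formula ψ id
    have h2 := P.h.map_formula ψ id
    exact h2.2 (h1.1 hψ))

noncomputable def PairState.next {L : FirstOrder.Language.{u, v}} (P : PairState L) :
    PairState L where
  B := P.D
  D := P.exists_next.choose
  sB := P.sD
  sD := P.exists_next.choose_spec.choose
  nD := P.exists_next.choose_spec.choose_spec.choose
  e := P.exists_next.choose_spec.choose_spec.choose_spec.choose
  h := P.exists_next.choose_spec.choose_spec.choose_spec.choose_spec.choose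

theorem PairState.next_spec {L : FirstOrder.Language.{u, v}} (P : PairState L) (x : P.B) :
    P.next.e (P.h x) = P.next.h (P.e x) :=
  P.exists_next.choose_spec.choose_spec.choose_spec.choose_spec.choose_spec x

noncomputable def PairState.seq {L : FirstOrder.Language.{u, v}} (P : PairState L) :
    ℕ → PairState L
  | 0 => P
  | n + 1 => (P.seq n).next

theorem auto_ext {L : FirstOrder.Language.{u, v}} (P : PairState L) :
    ∃ (E : Type (max u v)) (_ : L.Structure E) (g : P.D ↪ₑ[L] E) (s : E ≃[L] E),
      ∀ x, s (g (P.e x)) = g (P.h x) := by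
  let A : ℕ → Type (max u v) := fun n => (P.seq n).B
  let e : ∀ n, A n ↪ₑ[L] A (n + 1) := fun n => (P.seq n).e
  let h : ∀ n, A n ↪ₑ[L] A (n + 1) := fun n => (P.seq n).h
  have comm : ∀ n (x : A n), e (n + 1) (h n x) = h (n + 1) (e n x) :=
    fun n x => (P.seq n).next_spec x
  let C : ℕ → Type (max u v) := fun n => A (2 * n)
  let t : ∀ n, C n ↪ₑ[L] C (n + 1) := fun n => (h (2 * n + 1)).comp (e (2 * n))
  obtain ⟨E, sE, g, hg, hsur, huniv⟩ := chain_limit C (fun n => (t n).toEmbedding)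
  have hg' : ∀ n (x : A (2 * n)), g (n + 1) (h (2 * n + 1) (e (2 * n) x)) = g n x := hg
  obtain ⟨G1, hG1⟩ := chain_elem' C t E g hg hsur 1
  obtain ⟨S, hS⟩ := huniv
    (fun n => (g (n + 1)).comp ((h (2 * n + 1)).comp (h (2 * n))).toEmbedding) (by
      intro n x
      change g (n + 2) (h (2 * n + 3) (h (2 * n + 2) (h (2 * n + 1) (e (2 * n) x)))) =
        g (n + 1) (h (2 * n + 1) (h (2 * n) x))
      rw [← hg' (n + 1)]
      change _ = g (n + 2) (h (2 * n + 3) (e (2 * n + 2) (h (2 * n + 1) (h (2 * n) x))))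
      rw [comm, comm])
  obtain ⟨R, hR⟩ := huniv
    (fun n => (g (n + 1)).comp ((e (2 * n + 1)).comp (e (2 * n))).toEmbedding) (by
      intro n x
      change g (n + 2) (e (2 * n + 3) (e (2 * n + 2) (h (2 * n + 1) (e (2 * n) x)))) =
        g (n + 1) (e (2 * n + 1) (e (2 * n) x))
      rw [← hg' (n + 1)]
      change _ = g (n + 2) (h (2 * n + 3) (e (2 * n + 2) (e (2 * n + 1) (e (2 * n) x))))
      rw [comm, comm])
  have hS' : ∀ n (x : A (2 * n)), S (g n x) = g (n + 1) (h (2 * n + 1) (h (2 * n) x)) := hS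
  have hR' : ∀ n (x : A (2 * n)), R (g n x) = g (n + 1) (e (2 * n + 1) (e (2 * n) x)) := hR
  have hgg : ∀ n (x : A (2 * n)),
      g (n + 2) (h (2 * n + 3) (e (2 * n + 2) (h (2 * n + 1) (e (2 * n) x)))) = g n x := by
    intro n x
    rw [← hg' n x]
    exact hg' (n + 1) _
  have hRS : ∀ z, R (S z) = z := by
    intro z
    obtain ⟨n, x, rfl⟩ := hsur z
    rw [hS' n x, hR' (n + 1)]
    refine Eq.trans ?_ (hgg n x)
    change g (n + 2) (e (2 * n + 3) (e (2 * n + 2) (h (2 * n + 1) (h (2 * n) x)))) = _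
    rw [comm, comm, comm]
  have hSR : ∀ z, S (R z) = z := by
    intro z
    obtain ⟨n, x, rfl⟩ := hsur z
    rw [hR' n x, hS' (n + 1)]
    refine Eq.trans ?_ (hgg n x)
    change g (n + 2) (h (2 * n + 3) (h (2 * n + 2) (e (2 * n + 1) (e (2 * n) x)))) = _
    rw [comm]
  refine ⟨E, sE, G1.comp (e 1), ⟨⟨S, R, hRS, hSR⟩, ?_, ?_⟩, ?_⟩
  · intro n f x
    exact S.map_fun f x
  · intro n r x
    exact S.map_rel r x
  · intro (x : A 0)
    change S (G1 (e 1 (e 0 x))) = G1 (e 1 (h 0 x))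
    rw [hG1, hG1]
    have hc : e 1 (h 0 x) = h 1 (e 0 x) := comm 0 x
    have : R (g 0 x) = g 1 (e 1 (e 0 x)) := hR' 0 x
    exact (congrArg S this.symm).trans
      ((hSR _).trans ((hg' 0 x).symm.trans (congrArg (g 1) hc.symm)))

@[reducible] def redS (L : FirstOrder.Language.{u, v}) (N : Type w) [(Lsigma L).Structure N] :
    L.Structure N :=
  (LHom.sumInl (L := L) (L' := unaryFunctionLanguage)).reduct N

def redEmb (L : FirstOrder.Language.{u, v}) {M N : Type*} [(Lsigma L).Structure M]
    [(Lsigma L).Structure N] (f : M ↪[Lsigma L] N) :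
    @FirstOrder.Language.Embedding L M N (redS L M) (redS L N) :=
  @FirstOrder.Language.Embedding.mk L M N (redS L M) (redS L N) f.toEmbedding
    (fun {_} F x => f.map_fun (Sum.inl F) x) (fun {_} R x => f.map_rel (Sum.inl R) x)

theorem redEmb_apply (L : FirstOrder.Language.{u, v}) {M N : Type*} [(Lsigma L).Structure M]
    [(Lsigma L).Structure N] (f : M ↪[Lsigma L] N) (x : M) :
    (@FirstOrder.Language.Embedding.toEmbedding L M N (redS L M) (redS L N) (redEmb L f)) x
      = f x := rfl

theorem realizeL_iff (L : FirstOrder.Language.{u, v}) {α : Type*} {N : Type*}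
    [(Lsigma L).Structure N] (ψ : L.Formula α) (x : α → N) :
    ((LHom.sumInl (L := L) (L' := unaryFunctionLanguage)).onFormula ψ).Realize x ↔
      RealizeL L N ψ x := by
  let _ := redS L N
  exact LHom.realize_onFormula _ ψ

def redElem (L : FirstOrder.Language.{u, v}) {M N : Type*} [(Lsigma L).Structure M]
    [(Lsigma L).Structure N] (f : M ↪ₑ[Lsigma L] N) :
    @FirstOrder.Language.ElementaryEmbedding L M N (redS L M) (redS L N) :=
  @FirstOrder.Language.ElementaryEmbedding.mk L M N (redS L M) (redS L N) f
    (fun n ψ x => by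
      have h := f.map_formula
        ((LHom.sumInl (L := L) (L' := unaryFunctionLanguage)).onFormula ψ) x
      rw [realizeL_iff, realizeL_iff] at h
      exact h)

theorem emb_sigma (L : FirstOrder.Language.{u, v}) {M N : Type*} [(Lsigma L).Structure M]
    [(Lsigma L).Structure N] (f : M ↪[Lsigma L] N) (x : M) :
    f (sigmaMap L M x) = sigmaMap L N (f x) := by
  refine (f.map_fun _ _).trans ?_
  refine congrArg (funMap _) ?_
  funext i
  have hi : i = 0 := Subsingleton.elim _ _
  subst hi
  rfl

def sigT (L : FirstOrder.Language.{u, v}) {α : Type*} (t : (Lsigma L).Term α) :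
    (Lsigma L).Term α :=
  Term.func (l := 1) (L := Lsigma L)
    ((Sum.inr () : L.Functions 1 ⊕ unaryFunctionLanguage.Functions 1)) ![t]

theorem sigT_realize (L : FirstOrder.Language.{u, v}) {α : Type*} {N : Type*}
    [(Lsigma L).Structure N] (t : (Lsigma L).Term α) (x : α → N) :
    (sigT L t).realize x = sigmaMap L N (t.realize x) := by
  refine congrArg (funMap _) ?_
  funext i
  have hi : i = 0 := Subsingleton.elim _ _
  subst hi
  rfl

noncomputable def chi (L : FirstOrder.Language.{u, v}) {k : ℕ} (φ : L.Formula (Fin k ⊕ Fin k)) :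
    (Lsigma L).Formula (Fin k ⊕ Fin k) :=
  let φs := (LHom.sumInl (L := L) (L' := unaryFunctionLanguage)).onFormula φ
  Formula.iExs (Fin k)
    ((BoundedFormula.subst φs (Sum.elim (fun i => Term.var (Sum.inl (Sum.inl i)))
        (fun i => sigT L (Term.var (Sum.inr i)))) : (Lsigma L).Formula _) ⊓
     ((BoundedFormula.subst φs (Sum.elim (fun i => sigT L (Term.var (Sum.inr i)))
        (fun i => Term.var (Sum.inr i))) : (Lsigma L).Formula _) ⊓
      (BoundedFormula.subst φs (Sum.elim (fun i => Term.var (Sum.inr i))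
        (fun i => Term.var (Sum.inl (Sum.inr i)))) : (Lsigma L).Formula _)))

theorem chi_realize (L : FirstOrder.Language.{u, v}) {k : ℕ} (φ : L.Formula (Fin k ⊕ Fin k))
    {N : Type*} [(Lsigma L).Structure N] (a c : Fin k → N) :
    (chi L φ).Realize (Sum.elim a c) ↔ ∃ y : Fin k → N,
        RealizeL L N φ (Sum.elim a (sigmaMap L N ∘ y)) ∧
        RealizeL L N φ (Sum.elim (sigmaMap L N ∘ y) y) ∧
        RealizeL L N φ (Sum.elim y c) := by
  unfold chi
  rw [Formula.realize_iExs]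
  refine exists_congr fun y => ?_
  rw [Formula.realize_inf, Formula.realize_inf, ← realizeL_iff, ← realizeL_iff, ← realizeL_iff]
  unfold Formula.Realize
  rw [BoundedFormula.realize_subst, BoundedFormula.realize_subst, BoundedFormula.realize_subst]
  refine and_congr (iff_of_eq ?_) (and_congr (iff_of_eq ?_) (iff_of_eq ?_)) <;>
  · congr 1
    funext i
    rcases i with i | i <;> simp [sigT_realize]

theorem sur_of_elem (L : FirstOrder.Language.{u, v}) {M N : Type*} [(Lsigma L).Structure M]
    [(Lsigma L).Structure N] (f : M ↪ₑ[Lsigma L] N) (x : M) (h : ∃ w, sigmaMap L N w = f x) :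
    ∃ w, sigmaMap L M w = x := by
  let ψ : (Lsigma L).Formula (Fin 1) := Formula.iExs (Fin 1)
    (Term.equal (sigT L (Term.var (Sum.inr 0))) (Term.var (Sum.inl 0)))
  have hψ : ψ.Realize (fun _ => x) ↔ ∃ w, sigmaMap L M w = x := by
    rw [Formula.realize_iExs]
    simp only [Formula.realize_equal, sigT_realize, Term.realize_var, Sum.elim_inl, Sum.elim_inr]
    exact ⟨fun ⟨i, hi⟩ => ⟨i 0, hi⟩, fun ⟨i, hi⟩ => ⟨fun _ => i, hi⟩⟩
  have h1 := f.map_formula ψ (fun _ => x)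
  have hψ' : ψ.Realize (f ∘ fun _ => x) ↔ ∃ w, sigmaMap L N w = f x := by
    rw [Formula.realize_iExs]
    simp only [Formula.realize_equal, sigT_realize, Term.realize_var, Sum.elim_inl, Sum.elim_inr]
    exact ⟨fun ⟨i, hi⟩ => ⟨i 0, hi⟩, fun ⟨i, hi⟩ => ⟨fun _ => i, hi⟩⟩
  rw [hψ, hψ'] at h1
  exact h1.1 h

def toElem {L : FirstOrder.Language.{u, v}} {M N : Type*} [L.Structure M] [L.Structure N]
    (f : M ↪[L] N) (h : _root_.Embedding.IsElem f) : M ↪ₑ[L] N :=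
  ⟨f, fun _ ψ x => h ψ x⟩

structure TAMod (L : FirstOrder.Language.{u, v}) (TA : (Lsigma L).Theory) where
  X : Type (max u v)
  sX : (Lsigma L).Structure X
  hX : X ⊨ TA

attribute [instance] TAMod.sX

structure TsMod (L : FirstOrder.Language.{u, v}) (T : L.Theory) where
  X : Type (max u v)
  sX : (Lsigma L).Structure X
  hX : IsModelOfTsigma L T X

attribute [instance] TsMod.sX

theorem model_of_TA (L : FirstOrder.Language.{u, v}) (T : L.Theory)
    (hmc : TheoryIsModelComplete L T) (TA : (Lsigma L).Theory)
    (hTAmc : TheoryIsModelComplete (Lsigma L) TA)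
    (hTA1 : ∀ (M : Type (max u v)) (_ : (Lsigma L).Structure M), IsModelOfTsigma L T M →
      ∃ (K : Type (max u v)) (_ : (Lsigma L).Structure K),
        K ⊨ TA ∧ Nonempty (M ↪[Lsigma L] K))
    (hTA2 : ∀ (M : Type (max u v)) (_ : (Lsigma L).Structure M), M ⊨ TA →
      ∃ (K : Type (max u v)) (_ : (Lsigma L).Structure K),
        IsModelOfTsigma L T K ∧ Nonempty (M ↪[Lsigma L] K))
    (N : Type (max u v)) [iN : (Lsigma L).Structure N] (hN : N ⊨ TA) :
    IsModelOfTsigma L T N := by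
  have step : ∀ P : TAMod L TA, ∃ (Q : TAMod L TA) (K : TsMod L T),
      ∃ (_ : P.X ↪[Lsigma L] K.X) (_ : K.X ↪[Lsigma L] Q.X), True := by
    rintro ⟨X, sX, hX⟩
    obtain ⟨K, sK, hK, ⟨f⟩⟩ := hTA2 X sX hX
    obtain ⟨X', sX', hX', ⟨f'⟩⟩ := hTA1 K sK hK
    exact ⟨⟨X', sX', hX'⟩, ⟨K, sK, hK⟩, f, f', trivial⟩
  obtain ⟨C, iC, K, iK, hC, hK, F, F', hC0⟩ : ∃ (C : ℕ → Type (max u v))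
      (iC : ∀ n, (Lsigma L).Structure (C n)) (K : ℕ → Type (max u v))
      (iK : ∀ n, (Lsigma L).Structure (K n)) (_ : ∀ n, @Theory.Model _ (C n) (iC n) TA)
      (_ : ∀ n, @IsModelOfTsigma L T (K n) (iK n))
      (_ : ∀ n, @FirstOrder.Language.Embedding (Lsigma L) (C n) (K n) (iC n) (iK n))
      (_ : ∀ n, @FirstOrder.Language.Embedding (Lsigma L) (K n) (C (n+1)) (iK n) (iC (n+1))),
      (⟨C 0, iC 0⟩ : Σ X : Type (max u v), (Lsigma L).Structure X) = ⟨N, iN⟩ := by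
    choose nxt Kf f f' _ using step
    let sq : ℕ → TAMod L TA := fun n => Nat.rec ⟨N, iN, hN⟩ (fun _ P => nxt P) n
    exact ⟨fun n => (sq n).X, fun n => (sq n).sX, fun n => (Kf (sq n)).X,
      fun n => (Kf (sq n)).sX, fun n => (sq n).hX, fun n => (Kf (sq n)).hX, fun n => f (sq n),
      fun n => f' (sq n), rfl⟩
  obtain ⟨rfl, hC0⟩ := Sigma.mk.inj_iff.1 hC0
  cases eq_of_heq hC0
  let t : ∀ n : ℕ, C n ↪ₑ[Lsigma L] C (n + 1) := fun n =>
    toElem ((F' n).comp (F n)) (hTAmc _ _ (hC n) (hC (n + 1)) _)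
  obtain ⟨E, sE, g, hg, hsur, -⟩ := chain_limit C (fun n => (t n).toEmbedding)
  obtain ⟨G, -⟩ := chain_elem' C t E g hg hsur 0
  have hT : @Theory.Model L (C 0) (redS L (C 0)) T := by
    let _ : ∀ n, L.Structure (K n) := fun n => redS L (K n)
    let _ : L.Structure E := redS L E
    let _ : L.Structure (C 0) := redS L (C 0)
    let tK : ∀ n, K n ↪ₑ[L] K (n + 1) := fun n =>
      toElem (redEmb L ((F (n + 1)).comp (F' n)))
        (hmc _ _ (hK n).1 (hK (n + 1)).1 _)
    let gK : ∀ n, K n ↪[L] E := fun n => redEmb L ((g (n + 1)).comp (F' n))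
    obtain ⟨GK, -⟩ := chain_elem' K tK E gK (fun n x => hg (n + 1) (F' n x)) (by
      intro x
      obtain ⟨n, y, rfl⟩ := hsur x
      exact ⟨n, F n y, hg n y⟩) 0
    have hE : E ⊨ T := (GK.theory_model_iff T).1 (hK 0).1
    exact ((redElem L G).theory_model_iff T).2 hE
  let _ : L.Structure (K 0) := redS L (K 0)
  obtain ⟨eK, heK⟩ := (hK 0).2
  have heK' : ∀ x : K 0, @FirstOrder.Language.Equiv.toEquiv L (K 0) (K 0) (redS L (K 0)) (redS L (K 0)) eK x = sigmaMap L (K 0) x := fun x => congrFun heK x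
  let f0 : C 0 ↪[Lsigma L] K 0 := F 0
  have hinj : Function.Injective (sigmaMap L (C 0)) := by
    intro x y hxy
    apply f0.injective
    have h1 : sigmaMap L (K 0) (f0 x) = sigmaMap L (K 0) (f0 y) := by
      rw [← emb_sigma, ← emb_sigma, hxy]
    rw [← heK', ← heK'] at h1
    exact eK.toEquiv.injective h1
  have hsurj : Function.Surjective (sigmaMap L (C 0)) := by
    intro x
    refine sur_of_elem L (N := C 1) (t 0) x ⟨F' 0 (eK.toEquiv.symm (f0 x)), ?_⟩
    rw [← emb_sigma, ← heK', Equiv.apply_symm_apply]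
    rfl
  refine ⟨hT, ?_⟩
  let _ : L.Structure (C 0) := redS L (C 0)
  have hcomp : ∀ {n : ℕ} (x : Fin n → (C 0)), f0 ∘ sigmaMap L (C 0) ∘ x = eK.toEquiv ∘ f0 ∘ x := by
    intro n x
    funext i
    exact (emb_sigma L f0 (x i)).trans (heK' _).symm
  refine ⟨⟨Equiv.ofBijective (sigmaMap L (C 0)) ⟨hinj, hsurj⟩, ?_, ?_⟩, rfl⟩
  · intro n h x
    apply f0.injective
    refine (emb_sigma L f0 _).trans ?_
    refine (heK' _).symm.trans ?_
    have e1 := (redEmb L f0).map_fun h x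
    have e2 := (redEmb L f0).map_fun h (sigmaMap L (C 0) ∘ x)
    refine Eq.trans ?_ e2.symm
    refine (congrArg eK.toEquiv e1).trans ?_
    refine (eK.map_fun' h _).trans ?_
    exact congrArg (funMap h) (hcomp x).symm
  · intro n r x
    have e1 := (redEmb L f0).map_rel r x
    have e2 := (redEmb L f0).map_rel r (sigmaMap L (C 0) ∘ x)
    refine Iff.trans e2.symm (Iff.trans ?_ e1)
    refine Iff.trans (iff_of_eq (congrArg (RelMap r) (hcomp x))) ?_
    exact eK.map_rel' r _

theorem sat2 {L : FirstOrder.Language.{u, v}} {N : Type (max u v)} [L.Structure N]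
    {κ : Cardinal.{max u v}} (hκ : ℵ₀ ≤ κ) (hsat : IsSaturatedStruct L N κ) {k : ℕ}
    (φ : L.Formula (Fin k ⊕ Fin k)) (P R : Set (Fin k → N)) (hP : #P < κ) (hR : #R < κ)
    (x : ℕ → Fin k → N)
    (hxP : ∀ p ∈ P, ∀ᶠ n in Filter.atTop, φ.Realize (Sum.elim p (x n)))
    (hxR : ∀ r ∈ R, ∀ᶠ n in Filter.atTop, φ.Realize (Sum.elim (x n) r)) :
    ∃ d : Fin k → N, (∀ p ∈ P, φ.Realize (Sum.elim p d)) ∧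
      ∀ r ∈ R, φ.Realize (Sum.elim d r) := by
  classical
  let A : Set N := Set.range (fun q : ↥(P ∪ R) × Fin k => q.1.1 q.2)
  have hA : #A < κ := by
    refine mk_range_le.trans_lt ?_
    rw [mk_prod, lift_id', mk_fin, lift_natCast]
    refine mul_lt_of_lt hκ ?_ (natCast_lt_aleph0.trans_le hκ)
    exact (mk_union_le P R).trans_lt (add_lt_of_lt hκ hP hR)
  have hmP : ∀ p ∈ P, ∀ i, p i ∈ A := fun p hp i => ⟨(⟨p, Or.inl hp⟩, i), rfl⟩
  have hmR : ∀ p ∈ R, ∀ i, p i ∈ A := fun p hp i => ⟨(⟨p, Or.inr hp⟩, i), rfl⟩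
  let F : P ⊕ R → L.Formula (A ⊕ Fin k) := Sum.elim
    (fun p => φ.relabel (Sum.elim (fun i => Sum.inl ⟨p.1 i, hmP p.1 p.2 i⟩) Sum.inr))
    (fun r => φ.relabel (Sum.elim Sum.inr (fun i => Sum.inl ⟨r.1 i, hmR r.1 r.2 i⟩)))
  let G : P ⊕ R → (L[[↥A]]).Formula (Fin k) := fun i => BoundedFormula.constantsVarsEquiv.symm (F i)
  have hG : ∀ i (d : Fin k → N), (G i).Realize d ↔ (F i).Realize (Sum.elim (fun a : A => (a : N)) d) := by
    intro i d
    have h := BoundedFormula.realize_constantsVarsEquiv (L := L) (M := N) (φ := G i) (v := d) (xs := default)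
    rw [Equiv.apply_symm_apply] at h
    exact h.symm
  have hGP : ∀ (p : P) (d : Fin k → N), (G (Sum.inl p)).Realize d ↔ φ.Realize (Sum.elim p.1 d) := by
    intro p d
    rw [hG]
    refine Formula.realize_relabel.trans (iff_of_eq ?_)
    congr 1
    funext i
    rcases i with i | i <;> rfl
  have hGR : ∀ (p : R) (d : Fin k → N), (G (Sum.inr p)).Realize d ↔ φ.Realize (Sum.elim d p.1) := by
    intro p d
    rw [hG]
    refine Formula.realize_relabel.trans (iff_of_eq ?_)
    congr 1
    funext i
    rcases i with i | i <;> rfl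
  have hev : ∀ i, ∀ᶠ n in Filter.atTop, (G i).Realize (x n) := by
    rintro (p | r)
    · simpa only [hGP] using hxP p.1 p.2
    · simpa only [hGR] using hxR r.1 r.2
  obtain ⟨d, hd⟩ := hsat A hA k (Set.range G) (by
    intro q hq
    have h1 : ∀ᶠ n in Filter.atTop, ∀ ψ ∈ q, ψ.Realize (x n) := by
      rw [Filter.eventually_all_finset]
      intro ψ hψ
      obtain ⟨i, rfl⟩ := hq hψ
      exact hev i
    obtain ⟨n, hn⟩ := h1.exists
    exact ⟨x n, hn⟩)
  refine ⟨d, fun p hp => (hGP ⟨p, hp⟩ d).1 (hd _ ⟨_, rfl⟩), fun p hp => (hGR ⟨p, hp⟩ d).1 (hd _ ⟨_, rfl⟩)⟩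

theorem card_formula_le {L : FirstOrder.Language.{u, v}} {N : Type (max u v)} (S : Set N) (k : ℕ)
    (hS : #S ≤ L.card + ℵ₀) : #(L.Formula (S ⊕ Fin k)) ≤ L.card + ℵ₀ := by
  have h1 : #(L.Formula (S ⊕ Fin k)) ≤ #(Σ n, L.BoundedFormula (S ⊕ Fin k) n) :=
    mk_le_of_injective (f := fun ψ => ⟨0, ψ⟩) (fun a b h => by simpa using h)
  refine h1.trans (BoundedFormula.card_le.trans ?_)
  have h0 : ℵ₀ ≤ L.card + ℵ₀ := le_add_self
  refine max_le h0 ?_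
  simp only [mk_sum, lift_id, lift_uzero, mk_fin, lift_natCast, lift_id']
  have hk : (k : Cardinal) ≤ L.card + ℵ₀ := natCast_lt_aleph0.le.trans h0
  have hL : L.card ≤ L.card + ℵ₀ := le_self_add
  exact add_le_of_le h0 (add_le_of_le h0 (by simpa using hS) (by simpa using hk)) (by simpa using hL)

theorem core {L : FirstOrder.Language.{u, v}} {N : Type (max u v)} [L.Structure N]
    (s : N ≃[L] N) (S : Set N) (hSs : ∀ x ∈ S, s x ∈ S) (hS : #S ≤ L.card + ℵ₀)
    {κ : Cardinal.{max u v}} (hκ : 2 ^ (L.card + ℵ₀) < κ) (hsat : IsSaturatedStruct L N κ) {k : ℕ}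
    (φ : L.Formula (Fin k ⊕ Fin k)) (a : ℕ → Fin k → N)
    (ha : ∀ i j, i < j → φ.Realize (Sum.elim (a i) (a j)))
    (hs : ∀ i, s ∘ a i = a (i + 1)) (c : Fin k → N)
    (hc : ∀ i, φ.Realize (Sum.elim (a i) c)) :
    ∃ y z : Fin k → N, φ.Realize (Sum.elim (a 0) z) ∧ φ.Realize (Sum.elim z y) ∧
      φ.Realize (Sum.elim y c) ∧ ∀ ψ : L.Formula (S ⊕ Fin k),
        ψ.Realize (Sum.elim (fun m : S => (m : N)) y) ↔
        ψ.Realize (Sum.elim (fun m : S => s (m : N)) z) := by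
  have h0 : ℵ₀ ≤ L.card + ℵ₀ := le_add_self
  have hκ0 : ℵ₀ < κ := (h0.trans (cantor _).le).trans_lt hκ
  have hss : ∀ x y : Fin k → N, φ.Realize (Sum.elim (s ∘ x) (s ∘ y)) ↔ φ.Realize (Sum.elim x y) := by
    intro x y
    rw [← Sum.comp_elim]
    exact StrongHomClass.realize_formula s φ
  have hsi : ∀ x : Fin k → N, s ∘ (s.symm ∘ x) = x := by
    intro x; funext i; exact s.apply_symm_apply _
  let Q : Set (Fin k → N) := {u | (∀ i, φ.Realize (Sum.elim (a i) u)) ∧ φ.Realize (Sum.elim u (s ∘ c))}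
  let tp : (Fin k → N) → Set (L.Formula (S ⊕ Fin k)) := fun u =>
    {ψ | ψ.Realize (Sum.elim (fun m : S => (m : N)) u)}
  let Ty := ↥(tp '' Q)
  have hTy : #Ty ≤ 2 ^ (L.card + ℵ₀) := by
    refine (mk_set_le _).trans ?_
    rw [mk_set]
    exact power_le_power_left two_ne_zero (card_formula_le S k hS)
  choose rep hrepQ hrep using fun p : Ty => p.2
  let R : Set (Fin k → N) := {s ∘ c} ∪ Set.range (fun p : Ty => s.symm ∘ rep p)
  have hR : #R < κ := by
    refine (mk_union_le _ _).trans_lt (add_lt_of_lt hκ0.le ?_ ?_)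
    · rw [mk_singleton]; exact one_lt_aleph0.trans hκ0
    · exact mk_range_le.trans_lt (hTy.trans_lt hκ)
  have hP : #(Set.range a) < κ := by
    refine (lt_of_le_of_lt ?_ hκ0)
    exact le_aleph0_iff_set_countable.2 (Set.countable_range a)
  obtain ⟨d, hdP, hdR⟩ := sat2 hκ0.le hsat φ (Set.range a) R hP hR a (by
      rintro _ ⟨i, rfl⟩
      filter_upwards [Filter.eventually_gt_atTop i] with n hn using ha i n hn) (by
      rintro r (hr | ⟨p, rfl⟩)
      · rw [Set.mem_singleton_iff] at hr
        subst hr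
        filter_upwards [Filter.eventually_gt_atTop 0] with n hn
        obtain ⟨m, rfl⟩ := Nat.exists_eq_succ_of_ne_zero hn.ne'
        rw [Nat.succ_eq_add_one, ← hs, hss]
        exact hc m
      · refine Filter.Eventually.of_forall fun n => ?_
        rw [← hss, hs, hsi]
        exact (hrepQ p).1 _)
  have hdQ : d ∈ Q := ⟨fun i => hdP _ ⟨i, rfl⟩, hdR _ (Or.inl rfl)⟩
  let p : Ty := ⟨tp d, d, hdQ, rfl⟩
  refine ⟨s.symm ∘ rep p, d, hdQ.1 0, hdR _ (Or.inr ⟨p, rfl⟩), ?_, ?_⟩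
  · rw [← hss, hsi]
    exact (hrepQ p).2
  · intro ψ
    let sS : S → S := fun m => ⟨s m, hSs m m.2⟩
    have h1 : ψ.Realize (Sum.elim (fun m : S => (m : N)) (s.symm ∘ rep p)) ↔
        ψ.Realize (Sum.elim (fun m : S => s (m : N)) (rep p)) := by
      rw [← StrongHomClass.realize_formula s ψ, Sum.comp_elim, hsi]
      rfl
    rw [h1]
    have h2 : ∀ u : Fin k → N, ψ.Realize (Sum.elim (fun m : S => s (m : N)) u) ↔
        ψ.relabel (Sum.map sS id) ∈ tp u := by
      intro u
      refine Iff.trans (iff_of_eq ?_) Formula.realize_relabel.symm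
      congr 1
      funext i
      rcases i with i | i <;> rfl
    rw [h2, h2, hrep p]

theorem sub_exists (L : FirstOrder.Language.{u, v}) (N : Type (max u v)) [(Lsigma L).Structure N]
    (X : Set N) (hX : X.Finite) :
    ∃ S : (Lsigma L).ElementarySubstructure N, X ⊆ S ∧ #S ≤ L.card + ℵ₀ := by
  have h0 : ℵ₀ ≤ L.card + ℵ₀ := le_add_self
  rcases le_total (L.card + ℵ₀) #N with h | h
  · obtain ⟨S, hS, hc⟩ := exists_elementarySubstructure_card_eq (Lsigma L) X (L.card + ℵ₀) h0
      (by
        simp only [lift_id]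
        exact hX.lt_aleph0.le.trans h0)
      (by
        have h1 : unaryFunctionLanguage.card ≤ ℵ₀ := by
          have : Countable unaryFunctionLanguage.Symbols := by
            have h1 : ∀ l, Countable (unaryFunctionLanguage.Functions l) := by
              intro l
              match l with
              | 0 => exact inferInstanceAs (Countable Empty)
              | 1 => exact inferInstanceAs (Countable Unit)
              | (n + 2) => exact inferInstanceAs (Countable Empty)
            have h2 : ∀ l, Countable (unaryFunctionLanguage.Relations l) :=
              fun l => inferInstanceAs (Countable Empty)
            exact inferInstanceAs (Countable (_ ⊕ _))
          exact mk_le_aleph0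
        simp only [lift_id, Language.card_sum]
        have h2 : lift.{max u v} unaryFunctionLanguage.card ≤ ℵ₀ := by simpa using h1
        simpa using add_le_add_right h2 L.card)
      (by simpa using h)
    exact ⟨S, hS, le_of_eq (by simpa using hc)⟩
  · refine ⟨⊤, fun x _ => trivial, ?_⟩
    refine le_trans ?_ h
    exact mk_subtype_le _

theorem final (L : FirstOrder.Language.{u, v}) (T : L.Theory)
    (hmc : TheoryIsModelComplete L T) (TA : (Lsigma L).Theory)
    (hTAmc : TheoryIsModelComplete (Lsigma L) TA)
    (hTA1 : ∀ (M : Type (max u v)) (_ : (Lsigma L).Structure M), IsModelOfTsigma L T M →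
      ∃ (K : Type (max u v)) (_ : (Lsigma L).Structure K),
        K ⊨ TA ∧ Nonempty (M ↪[Lsigma L] K))
    (hTA2 : ∀ (M : Type (max u v)) (_ : (Lsigma L).Structure M), M ⊨ TA →
      ∃ (K : Type (max u v)) (_ : (Lsigma L).Structure K),
        IsModelOfTsigma L T K ∧ Nonempty (M ↪[Lsigma L] K))
    (N : Type (max u v)) [instN : (Lsigma L).Structure N] [Nonempty N] (hN : N ⊨ TA)
    (κ : Cardinal.{max u v}) (hκ : 2 ^ (Language.card L + ℵ₀) < κ)
    (hsat : IsSaturatedLReduct L N κ) {k : ℕ} (φ : L.Formula (Fin k ⊕ Fin k))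
    (a : ℕ → Fin k → N) (ha : ∀ i j, i < j → RealizeL L N φ (Sum.elim (a i) (a j)))
    (hs : ∀ i, sigmaMap L N ∘ a i = a (i + 1)) (c : Fin k → N)
    (hc : ∀ i, RealizeL L N φ (Sum.elim (a i) c)) :
      ∃ y : Fin k → N,
        RealizeL L N φ (Sum.elim (a 0) (sigmaMap L N ∘ y)) ∧
        RealizeL L N φ (Sum.elim (sigmaMap L N ∘ y) y) ∧
        RealizeL L N φ (Sum.elim y c) := by
  let iN : L.Structure N := redS L N
  obtain ⟨hNT, s, hsig⟩ := model_of_TA L T hmc TA hTAmc hTA1 hTA2 N hN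
  obtain ⟨S, hSX, hScard⟩ := sub_exists L N (Set.range (a 0) ∪ Set.range c)
    ((Set.finite_range _).union (Set.finite_range _))
  have hSs : ∀ x ∈ (S : Set N), s x ∈ (S : Set N) := by
    intro x hx
    have h1 := emb_sigma L S.subtype.toEmbedding ⟨x, hx⟩
    have h2 : s x = sigmaMap L N x := congrFun hsig x
    have h3 : s x = (sigmaMap L S ⟨x, hx⟩ : S) := h2.trans h1.symm
    rw [h3]
    exact Subtype.coe_prop _
  obtain ⟨y, z, h1, h2, h3, htp⟩ := core s (S : Set N) hSs hScard hκ hsat φ a ha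
    (fun i => by rw [hsig]; exact hs i) c hc
  obtain ⟨D, sD, nD, e, h, heh⟩ := jep (L := L) (X := (S : Set N) ⊕ Fin k)
    (Sum.elim (fun m : (S : Set N) => s (m : N)) z)
    (Sum.elim (fun m : (S : Set N) => (m : N)) y) (fun ψ hψ => (htp ψ).1 hψ)
  obtain ⟨E, sE, g, τ, hτ⟩ := auto_ext (L := L) ⟨N, D, iN, sD, nD, e, h⟩
  let j : N ↪ₑ[L] E := g.comp e
  have hjS : ∀ m : N, m ∈ (S : Set N) → τ (j m) = j (s m) := fun m hm =>
    (hτ m).trans (congrArg g (heh (Sum.inl ⟨m, hm⟩))).symm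
  have hjy : ∀ i, τ (j (y i)) = j (z i) := fun i =>
    (hτ (y i)).trans (congrArg g (heh (Sum.inr i))).symm
  have hET : E ⊨ T := (j.theory_model_iff T).1 hNT
  let iE : (Lsigma L).Structure E := structureWithSigma L E τ
  have hE : IsModelOfTsigma L T E := ⟨hET, τ, rfl⟩
  let f : S ↪[Lsigma L] E :=
    { toFun := fun m => j m
      inj' := fun m m' hm => Subtype.ext (j.injective hm)
      map_fun' := by
        intro n F x
        match n, F, x with
        | n, Sum.inl F, x => exact j.map_fun F (fun i => (x i : N))
        | 0, Sum.inr F, x => exact nomatch F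
        | 1, Sum.inr F, x =>
          have q1 : ((sigmaMap L S (x 0) : S) : N) = s (x 0) :=
            (emb_sigma L S.subtype.toEmbedding (x 0)).trans (congrFun hsig _).symm
          have q2 : funMap (L := Lsigma L) (M := S) (Sum.inr F : (Lsigma L).Functions 1) x
              = sigmaMap L S (x 0) := by
            refine congrArg (funMap _) ?_
            funext i
            have hi : i = 0 := Subsingleton.elim _ _
            subst hi
            rfl
          exact (congrArg (fun t : S => j (t : N)) q2).trans
            ((congrArg j q1).trans (hjS _ (x 0).2).symm)
        | (n + 2), Sum.inr F, x => exact nomatch F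
      map_rel' := by
        intro n R x
        match n, R, x with
        | n, Sum.inl R, x => exact j.map_rel R (fun i => (x i : N))
        | n, Sum.inr R, x => exact nomatch R }
  obtain ⟨K, sK, hK, ⟨p⟩⟩ := hTA1 E iE hE
  have hST : S ⊨ TA := (S.subtype.theory_model_iff TA).2 hN
  have hKT := model_of_TA L T hmc TA hTAmc hTA1 hTA2 K hK
  let q : S ↪ₑ[Lsigma L] K := toElem (p.comp f) (hTAmc _ _ hST hK _)
  let iK : L.Structure K := redS L K
  let pL : E ↪ₑ[L] K := toElem (redEmb L p) (hmc _ _ hET hKT.1 _)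
  have hpz : ∀ u w : Fin k → N, φ.Realize (Sum.elim u w) →
      RealizeL L K φ (Sum.elim (p ∘ j ∘ u) (p ∘ j ∘ w)) := by
    intro u w huw
    have w1 := (j.map_formula φ _).2 huw
    have w2 := (pL.map_formula φ _).2 w1
    rw [Sum.comp_elim, Sum.comp_elim] at w2
    exact w2
  have hsy : sigmaMap L K ∘ (p ∘ j ∘ y) = p ∘ j ∘ z := by
    funext i
    refine (emb_sigma L p (j (y i))).symm.trans (congrArg p ?_)
    exact hjy i
  let a' : Fin k → S := fun i => ⟨a 0 i, hSX (Or.inl ⟨i, rfl⟩)⟩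
  let c' : Fin k → S := fun i => ⟨c i, hSX (Or.inr ⟨i, rfl⟩)⟩
  have hchiK : (chi L φ).Realize (Sum.elim (q ∘ a') (q ∘ c')) := by
    rw [chi_realize]
    refine ⟨p ∘ j ∘ y, ?_, ?_, ?_⟩
    · rw [hsy]; exact hpz _ _ h1
    · rw [hsy]; exact hpz _ _ h2
    · exact hpz _ _ h3
  rw [← Sum.comp_elim, q.map_formula] at hchiK
  have hchiN := (S.subtype.map_formula (chi L φ) _).2 hchiK
  rw [Sum.comp_elim] at hchiN
  exact (chi_realize L φ (a 0) c).1 hchiN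

end Helpers

/-- Let `T` be a model complete `L`-theory, `φ` an `L`-formula defining
a transitive irreflexive relation `<` on `k`-tuples of a model `M₀` of `T`, `(a_i)_{i<ω}`
a `<`-increasing sequence of `k`-tuples of `M₀`, and `σ₀` an `L`-automorphism of `M₀`
with `σ₀(a_i) = a_{i+1}`.  Suppose `TA` is a model companion of `T_σ`, `(N, σ)` is a
model of `TA` extending the `L_σ`-structure `(M₀, σ₀)`, and `N` is `κ`-saturated as an
`L`-structure for some `κ > 2^(|L| + ℵ₀)`.  Then for every `k`-tuple `c` of `N` with
`a_i < c` for all `i < ω` there is a `k`-tuple `y` of `N` with `a₀ < σ(y)`, `σ(y) < y`,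
and `y < c`. -/
theorem stmt_10 (L : FirstOrder.Language.{u, v}) (T : L.Theory)
    (hmc : TheoryIsModelComplete L T)
    (k : ℕ) (hk : 1 ≤ k) (φ : L.Formula (Fin k ⊕ Fin k))
    (M₀ : Type (max u v)) (instM₀ : L.Structure M₀) (hM₀ : M₀ ⊨ T)
    (htrans : Transitive (fun x y : Fin k → M₀ => φ.Realize (Sum.elim x y)))
    (hirrefl : Irreflexive (fun x y : Fin k → M₀ => φ.Realize (Sum.elim x y)))
    (a : ℕ → Fin k → M₀)
    (hchain : ∀ i j : ℕ, i < j → φ.Realize (Sum.elim (a i) (a j)))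
    (σ₀ : M₀ ≃[L] M₀) (hσ₀ : ∀ (i : ℕ) (m : Fin k), σ₀ (a i m) = a (i + 1) m)
    (TA : (Lsigma L).Theory)
    (hTAmc : TheoryIsModelComplete (Lsigma L) TA)
    (hTA1 : ∀ (M : Type (max u v)) (_ : (Lsigma L).Structure M), IsModelOfTsigma L T M →
      ∃ (K : Type (max u v)) (_ : (Lsigma L).Structure K),
        K ⊨ TA ∧ Nonempty (M ↪[Lsigma L] K))
    (hTA2 : ∀ (M : Type (max u v)) (_ : (Lsigma L).Structure M), M ⊨ TA →
      ∃ (K : Type (max u v)) (_ : (Lsigma L).Structure K),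
        IsModelOfTsigma L T K ∧ Nonempty (M ↪[Lsigma L] K))
    (N : Type (max u v)) (instN : (Lsigma L).Structure N) (hN : N ⊨ TA)
    (ι : @FirstOrder.Language.Embedding (Lsigma L) M₀ N
      (structureWithSigma L M₀ ⇑σ₀) instN)
    (κ : Cardinal.{max u v}) (hκ : 2 ^ (Language.card L + ℵ₀) < κ)
    (hsat : IsSaturatedLReduct L N κ) :
    ∀ c : Fin k → N, (∀ i : ℕ, RealizeL L N φ (Sum.elim (⇑ι ∘ a i) c)) →
      ∃ y : Fin k → N,
        RealizeL L N φ (Sum.elim (⇑ι ∘ a 0) (sigmaMap L N ∘ y)) ∧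
        RealizeL L N φ (Sum.elim (sigmaMap L N ∘ y) y) ∧
        RealizeL L N φ (Sum.elim y c) := by
  intro c hc
  have hne : Nonempty N := ⟨c ⟨0, hk⟩⟩
  let i0 : (Lsigma L).Structure M₀ := structureWithSigma L M₀ ⇑σ₀
  have hNs := model_of_TA L T hmc TA hTAmc hTA1 hTA2 N hN
  let ιL : @FirstOrder.Language.Embedding L M₀ N instM₀ (redS L N) :=
    @FirstOrder.Language.Embedding.mk L M₀ N instM₀ (redS L N) ι.toEmbedding
      (fun {_} F x => ι.map_fun' (Sum.inl F) x) (fun {_} R x => ι.map_rel' (Sum.inl R) x)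
  have hel := @hmc M₀ N instM₀ (redS L N) hM₀ hNs.1 ιL
  let ιE : @FirstOrder.Language.ElementaryEmbedding L M₀ N instM₀ (redS L N) :=
    @toElem L M₀ N instM₀ (redS L N) ιL hel
  refine final L T hmc TA hTAmc hTA1 hTA2 N hN κ hκ hsat φ (fun i => ⇑ι ∘ a i) ?_ ?_ c hc
  · intro i j hij
    have h := (@FirstOrder.Language.ElementaryEmbedding.map_formula L M₀ N instM₀ (redS L N) ιE
      _ φ (Sum.elim (a i) (a j))).2 (hchain i j hij)
    rw [Sum.comp_elim] at h
    exact h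
  · intro i
    funext m
    have h := @emb_sigma L M₀ N (structureWithSigma L M₀ ⇑σ₀) instN ι (a i m)
    refine h.symm.trans (congrArg ι ?_)
    exact hσ₀ i m
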